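/- Let (Z₁, Z₂, Z₃) be a centered Gaussian random vector with covariance matrix ((3,0,1),(0,1,0),(1,0,3)). Then for every interval I ⊆ ℝ, E[|Z₁Z₃ − Z₂²| · (3Z₃ − Z₁)² · 𝟙{(Z₁+Z₃)/√8 ∈ I}] = 8 ∫_I √(2/π)(−4 + t² + t⁴ + 2e^{−t²}(4 + 3t²))e^{−t²/2} dt. (Equivalently, p₂(t) := √8 · E[(3t − √2 Z₁)² |Z₁Z₃ − Z₂²| | Z₁+Z₃ = √8 t] · φ_{Z₁+Z₃}(√8 t) equals √(2/π)(−4 + t² + t⁴ + 2e^{−t²}(4 + 3t²))e^{−t²/2}.) -/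

import Mathlib

open MeasureTheory ProbabilityTheory Real

noncomputable section

/-- the covariance matrix `((3,0,1),(0,1,0),(1,0,3))` -/
def covM : Matrix (Fin 3) (Fin 3) ℝ := !![3, 0, 1; 0, 1, 0; 1, 0, 3]

/-- `Z = (Z₁, Z₂, Z₃)` is a centered Gaussian random vector with covariance matrix
`covM`: every linear combination of its components is a centered real Gaussian random
variable with the corresponding variance `cᵀ covM c`. -/
def IsGaussianZ {Ω : Type} [MeasureSpace Ω] (Z : Ω → Fin 3 → ℝ) : Prop :=
  ∀ c : Fin 3 → ℝ,
    Measure.map (fun ω => ∑ i, c i * Z ω i) (volume : Measure Ω) =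
      gaussianReal 0 (∑ i, ∑ j, c i * covM i j * c j).toNNReal

lemma IsGaussianZ.aemeasurable {Ω : Type} [MeasureSpace Ω] {Z : Ω → Fin 3 → ℝ}
    (hZ : IsGaussianZ Z) (i : Fin 3) : AEMeasurable (fun ω => Z ω i) volume := by
  have h := hZ (Pi.single i 1)
  have he : (fun ω => ∑ j, (Pi.single i 1 : Fin 3 → ℝ) j * Z ω j) = fun ω => Z ω i := by
    funext ω
    simp [Pi.single_apply]
  rw [he] at h
  refine AEMeasurable.of_map_ne_zero ?_
  rw [h]
  exact IsProbabilityMeasure.ne_zero _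

lemma charFunDual_gaussianReal_zero_one (L : StrongDual ℝ ℝ) :
    charFunDual (gaussianReal 0 1) L = Complex.exp (-(((L 1) ^ 2 / 2 : ℝ) : ℂ)) := by
  have hL : (L : ℝ → ℝ) = fun x => L 1 * x := by
    funext x
    conv_lhs => rw [← mul_one x, ← smul_eq_mul, map_smul, smul_eq_mul, mul_comm]
  rw [charFunDual_eq_charFun_map_one, hL, charFun_map_mul, charFun_gaussianReal]
  congr 1
  push_cast
  simp only [mul_one]
  ring

lemma IsGaussianZ.aemeasurable_normalized {Ω : Type} [MeasureSpace Ω] {Z : Ω → Fin 3 → ℝ}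
    (hZ : IsGaussianZ Z) :
    AEMeasurable (fun ω => ((Z ω 0 + Z ω 2) / √8, ((Z ω 0 - Z ω 2) / 2, Z ω 1))) volume := by
  have h0 := hZ.aemeasurable 0
  have h1 := hZ.aemeasurable 1
  have h2 := hZ.aemeasurable 2
  exact ((h0.add h2).div_const _).prodMk (((h0.sub h2).div_const _).prodMk h1)

/-- The sum, difference and middle coordinate of `Z` are, after normalisation, independent
standard Gaussians. -/
lemma IsGaussianZ.map_eq_prod {Ω : Type} [MeasureSpace Ω]
    [IsProbabilityMeasure (volume : Measure Ω)] {Z : Ω → Fin 3 → ℝ} (hZ : IsGaussianZ Z) :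
    Measure.map (fun ω => ((Z ω 0 + Z ω 2) / √8, ((Z ω 0 - Z ω 2) / 2, Z ω 1)))
      (volume : Measure Ω) =
      (gaussianReal 0 1).prod ((gaussianReal 0 1).prod (gaussianReal 0 1)) := by
  have hm := hZ.aemeasurable_normalized
  have : IsProbabilityMeasure (Measure.map
      (fun ω => ((Z ω 0 + Z ω 2) / √8, ((Z ω 0 - Z ω 2) / 2, Z ω 1))) (volume : Measure Ω)) :=
    Measure.isProbabilityMeasure_map hm
  refine Measure.ext_of_charFunDual ?_
  funext L
  rw [charFunDual_prod, charFunDual_prod]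
  simp only [charFunDual_gaussianReal_zero_one]
  rw [charFunDual_eq_charFun_map_one,
    AEMeasurable.map_map_of_aemeasurable L.continuous.measurable.aemeasurable hm]
  set x := L (1, 0, 0) with hx
  set y := L (0, 1, 0) with hy
  set z := L (0, 0, 1) with hz
  have hL : ∀ a b c : ℝ, L (a, b, c) = a * x + b * y + c * z := by
    intro a b c
    have : ((a, b, c) : ℝ × ℝ × ℝ) =
        a • ((1, 0, 0) : ℝ × ℝ × ℝ) + b • ((0, 1, 0) : ℝ × ℝ × ℝ) +
          c • ((0, 0, 1) : ℝ × ℝ × ℝ) := by simp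
    rw [this, map_add, map_add, map_smul, map_smul, map_smul]
    simp [hx, hy, hz]
  have h8 : (√8)⁻¹ ^ 2 = (1 / 8 : ℝ) := by
    rw [inv_pow, Real.sq_sqrt (by norm_num)]
    norm_num
  have hcomp : (L ∘ fun ω => ((Z ω 0 + Z ω 2) / √8, ((Z ω 0 - Z ω 2) / 2, Z ω 1))) =
      fun ω => ∑ i, (![x * (√8)⁻¹ + y / 2, z, x * (√8)⁻¹ - y / 2] : Fin 3 → ℝ) i * Z ω i := by
    funext ω
    simp only [Function.comp, hL, Fin.sum_univ_three, Matrix.cons_val]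
    ring
  have hvar : (∑ i, ∑ j, (![x * (√8)⁻¹ + y / 2, z, x * (√8)⁻¹ - y / 2] : Fin 3 → ℝ) i *
      covM i j * (![x * (√8)⁻¹ + y / 2, z, x * (√8)⁻¹ - y / 2] : Fin 3 → ℝ) j) =
      x ^ 2 + y ^ 2 + z ^ 2 := by
    simp only [Fin.sum_univ_three, covM, Matrix.cons_val, Matrix.of_apply, Matrix.cons_val',
      Matrix.cons_val_fin_one]
    linear_combination 8 * x ^ 2 * h8
  rw [hcomp, hZ, hvar, charFun_gaussianReal, ← Complex.exp_add, ← Complex.exp_add,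
    Real.coe_toNNReal _ (by positivity)]
  simp only [ContinuousLinearMap.comp_apply, ContinuousLinearMap.inl_apply,
    ContinuousLinearMap.inr_apply]
  congr 1
  rw [← hz, ← hy]
  change _ = -(((L (1, 0, 0)) ^ 2 / 2 : ℝ) : ℂ) + _
  rw [← hx]
  push_cast
  ring

lemma integrable_pow_mul_exp_neg_sq_div_two (n : ℕ) :
    Integrable (fun r : ℝ => r ^ n * exp (-(r ^ 2 / 2))) := by
  have h := integrable_rpow_mul_exp_neg_mul_sq (b := 1 / 2) (by norm_num) (s := n)
    (by have : (0 : ℝ) ≤ n := n.cast_nonneg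
        linarith)
  refine h.congr (.of_forall fun r => ?_)
  simp only [Real.rpow_natCast]
  congr 2
  ring

lemma tendsto_even_pow_mul_exp_neg_sq_div_two (n : ℕ) :
    Filter.Tendsto (fun r : ℝ => r ^ (2 * n) * exp (-(r ^ 2 / 2))) Filter.atTop (nhds 0) := by
  have h : Filter.Tendsto (fun r : ℝ => r ^ 2 / 2) Filter.atTop Filter.atTop :=
    (Filter.tendsto_pow_atTop two_ne_zero).atTop_div_const two_pos
  have := ((Real.tendsto_pow_mul_exp_neg_atTop_nhds_zero n).comp h).const_mul (2 ^ n)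
  rw [mul_zero] at this
  refine this.congr fun r => ?_
  simp only [Function.comp, div_pow, pow_mul]
  field_simp

lemma integrable_abs_sq_sub_sq_mul_pow_mul_exp (c : ℝ) (n : ℕ) :
    Integrable (fun r : ℝ => |c ^ 2 - r ^ 2| * r ^ n * exp (-(r ^ 2 / 2))) := by
  have h := ((integrable_pow_mul_exp_neg_sq_div_two n).const_mul (c ^ 2)).sub
    (integrable_pow_mul_exp_neg_sq_div_two (n + 2))
  refine h.mono (by fun_prop) (.of_forall fun r => le_of_eq ?_)
  have : c ^ 2 * (r ^ n * exp (-(r ^ 2 / 2))) - r ^ (n + 2) * exp (-(r ^ 2 / 2)) =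
    (c ^ 2 - r ^ 2) * r ^ n * exp (-(r ^ 2 / 2)) := by ring
  simp only [Pi.sub_apply, this, norm_mul, Real.norm_eq_abs, abs_abs]

lemma integral_radial (c : ℝ) :
    ∫ r in Set.Ioi (0 : ℝ), r * |c ^ 2 - r ^ 2| * (c ^ 2 + 2 * r ^ 2) * exp (-(r ^ 2 / 2)) =
      4 * exp (-(c ^ 2 / 2)) * (3 * c ^ 2 + 8) + c ^ 4 + 2 * c ^ 2 - 16 := by
  set F : ℝ → ℝ := fun r =>
    (2 * r ^ 4 + (8 - c ^ 2) * r ^ 2 + 16 - 2 * c ^ 2 - c ^ 4) * exp (-(r ^ 2 / 2)) with hF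
  set f : ℝ → ℝ := fun r => r * (c ^ 2 - r ^ 2) * (c ^ 2 + 2 * r ^ 2) * exp (-(r ^ 2 / 2)) with hf
  have hderiv : ∀ r, HasDerivAt F (f r) r := by
    intro r
    have hp : HasDerivAt (fun r : ℝ => 2 * r ^ 4 + (8 - c ^ 2) * r ^ 2 + 16 - 2 * c ^ 2 - c ^ 4)
        (8 * r ^ 3 + 2 * (8 - c ^ 2) * r) r := by
      have := (((((hasDerivAt_pow 4 r).const_mul 2).add
        ((hasDerivAt_pow 2 r).const_mul (8 - c ^ 2))).add_const 16).sub_const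
          (2 * c ^ 2)).sub_const (c ^ 4)
      refine this.congr_deriv ?_
      norm_num
      ring
    have he : HasDerivAt (fun r : ℝ => exp (-(r ^ 2 / 2))) (exp (-(r ^ 2 / 2)) * (-r)) r := by
      refine (((hasDerivAt_pow 2 r).div_const 2).neg.exp).congr_deriv ?_
      norm_num
    refine (hp.mul he).congr_deriv ?_
    simp only [hf]
    ring
  have hfi : Integrable f := by
    have h := ((integrable_pow_mul_exp_neg_sq_div_two 1).const_mul (c ^ 4)).add
      (((integrable_pow_mul_exp_neg_sq_div_two 3).const_mul (c ^ 2)).sub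
        ((integrable_pow_mul_exp_neg_sq_div_two 5).const_mul 2))
    refine h.congr (.of_forall fun r => ?_)
    simp only [hf, Pi.add_apply, Pi.sub_apply]
    ring
  have hlim : Filter.Tendsto F Filter.atTop (nhds 0) := by
    have h := (((tendsto_even_pow_mul_exp_neg_sq_div_two 2).const_mul 2).add
      ((tendsto_even_pow_mul_exp_neg_sq_div_two 1).const_mul (8 - c ^ 2))).add
      ((tendsto_even_pow_mul_exp_neg_sq_div_two 0).const_mul (16 - 2 * c ^ 2 - c ^ 4))
    simp only [mul_zero, add_zero] at h
    refine h.congr fun r => ?_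
    simp only [hF]
    ring
  set g : ℝ → ℝ := fun r => r * |c ^ 2 - r ^ 2| * (c ^ 2 + 2 * r ^ 2) * exp (-(r ^ 2 / 2)) with hg
  have hgi : Integrable g := by
    refine hfi.mono (by fun_prop) (.of_forall fun r => le_of_eq ?_)
    simp only [hf, hg, norm_mul, Real.norm_eq_abs, abs_abs]
  have hc : (0 : ℝ) ≤ |c| := abs_nonneg c
  have hnear : ∫ r in Set.Ioc 0 |c|, g r = F |c| - F 0 := by
    rw [← intervalIntegral.integral_eq_sub_of_hasDerivAt (fun r _ => hderiv r)
      hfi.intervalIntegrable, intervalIntegral.integral_of_le hc]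
    refine setIntegral_congr_fun measurableSet_Ioc fun r hr => ?_
    have : r ^ 2 ≤ c ^ 2 := by
      rw [← sq_abs c]
      exact pow_le_pow_left₀ hr.1.le hr.2 2
    simp only [hf, hg, abs_of_nonneg (sub_nonneg.2 this)]
  have hfar : ∫ r in Set.Ioi |c|, g r = F |c| := by
    have h := integral_Ioi_of_hasDerivAt_of_tendsto (a := |c|)
      (hderiv |c|).continuousAt.continuousWithinAt (fun r _ => hderiv r) hfi.integrableOn hlim
    have hneg : ∫ r in Set.Ioi |c|, g r = ∫ r in Set.Ioi |c|, -f r := by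
      refine setIntegral_congr_fun measurableSet_Ioi fun r hr => ?_
      have : c ^ 2 ≤ r ^ 2 := by
        rw [← sq_abs c]
        exact pow_le_pow_left₀ hc (le_of_lt hr) 2
      simp only [hf, hg, abs_of_nonpos (sub_nonpos.2 this)]
      ring
    rw [hneg, integral_neg, h]
    ring
  rw [← Set.Ioc_union_Ioi_eq_Ioi hc, setIntegral_union (Set.Ioc_disjoint_Ioi le_rfl)
    measurableSet_Ioi hgi.integrableOn hgi.integrableOn, hnear, hfar]
  have h4 : |c| ^ 4 = c ^ 4 := by rw [show 4 = 2 * 2 from rfl, pow_mul, sq_abs, ← pow_mul]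
  simp only [hF, sq_abs, h4]
  norm_num
  ring

lemma integral_cos_Ioo_neg_pi_pi : ∫ θ in Set.Ioo (-π) π, cos θ = 0 := by
  rw [← integral_Ioc_eq_integral_Ioo, ← intervalIntegral.integral_of_le (by linarith [pi_pos])]
  simp

lemma integral_cos_sq_Ioo_neg_pi_pi : ∫ θ in Set.Ioo (-π) π, cos θ ^ 2 = π := by
  rw [← integral_Ioc_eq_integral_Ioo, ← intervalIntegral.integral_of_le (by linarith [pi_pos])]
  simp

lemma integral_prod_gaussianReal_zero_one (f : ℝ × ℝ → ℝ) :
    ∫ w, f w ∂((gaussianReal 0 1).prod (gaussianReal 0 1)) =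
      ∫ w : ℝ × ℝ, (2 * π)⁻¹ * exp (-((w.1 ^ 2 + w.2 ^ 2) / 2)) * f w := by
  rw [gaussianReal_of_var_ne_zero 0 one_ne_zero,
    prod_withDensity (measurable_gaussianPDF 0 1) (measurable_gaussianPDF 0 1),
    integral_withDensity_eq_integral_toReal_smul (by fun_prop)
      (.of_forall fun w => ENNReal.mul_lt_top gaussianPDF_lt_top gaussianPDF_lt_top)]
  refine integral_congr_ae (.of_forall fun w => ?_)
  have hs : √(2 * π) * √(2 * π) = 2 * π := Real.mul_self_sqrt (by positivity)
  simp only [ENNReal.toReal_mul, toReal_gaussianPDF, gaussianPDFReal, smul_eq_mul, sub_zero,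
    NNReal.coe_one, mul_one]
  have he : exp (-((w.1 ^ 2 + w.2 ^ 2) / 2)) = exp (-w.1 ^ 2 / 2) * exp (-w.2 ^ 2 / 2) := by
    rw [← exp_add]
    congr 1
    ring
  have hinv : (2 * π)⁻¹ = (√(2 * π))⁻¹ * (√(2 * π))⁻¹ := by rw [← mul_inv, hs]
  rw [he, hinv]
  ring

lemma integral_abs_mul_sq_gaussian (c : ℝ) :
    ∫ w : ℝ × ℝ, |c ^ 2 - w.1 ^ 2 - w.2 ^ 2| * (2 * c - 4 * w.1) ^ 2
      ∂((gaussianReal 0 1).prod (gaussianReal 0 1)) =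
      4 * (4 * exp (-(c ^ 2 / 2)) * (3 * c ^ 2 + 8) + c ^ 4 + 2 * c ^ 2 - 16) := by
  rw [integral_prod_gaussianReal_zero_one, ← integral_comp_polarCoord_symm, polarCoord_target,
    Measure.volume_eq_prod, ← Measure.prod_restrict, ← integral_radial]
  set κ : ℕ → ℝ → ℝ := fun n r => |c ^ 2 - r ^ 2| * r ^ n * exp (-(r ^ 2 / 2)) with hκ
  have hκi : ∀ n, IntegrableOn (κ n) (Set.Ioi 0) := fun n =>
    (integrable_abs_sq_sub_sq_mul_pow_mul_exp c n).integrableOn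
  have hcos : ∀ n : ℕ, IntegrableOn (fun θ => cos θ ^ n) (Set.Ioo (-π) π) := fun n =>
    ((by fun_prop : Continuous fun θ => cos θ ^ n).integrableOn_Icc).mono_set Set.Ioo_subset_Icc_self
  have hi : ∀ m n : ℕ, Integrable (fun p : ℝ × ℝ => κ m p.1 * cos p.2 ^ n)
      ((volume.restrict (Set.Ioi 0)).prod (volume.restrict (Set.Ioo (-π) π))) := fun m n =>
    (hκi m).mul_prod (hcos n)
  have hpolar : ∀ p : ℝ × ℝ, p.1 • ((2 * π)⁻¹ *
      exp (-(((polarCoord.symm p).1 ^ 2 + (polarCoord.symm p).2 ^ 2) / 2)) *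
      (|c ^ 2 - (polarCoord.symm p).1 ^ 2 - (polarCoord.symm p).2 ^ 2| *
        (2 * c - 4 * (polarCoord.symm p).1) ^ 2)) =
      (2 * π)⁻¹ * (4 * c ^ 2 * (κ 1 p.1 * cos p.2 ^ 0) - 16 * c * (κ 2 p.1 * cos p.2 ^ 1) +
        16 * (κ 3 p.1 * cos p.2 ^ 2)) := by
    intro p
    have hsum : (p.1 * cos p.2) ^ 2 + (p.1 * sin p.2) ^ 2 = p.1 ^ 2 := by
      linear_combination p.1 ^ 2 * sin_sq_add_cos_sq p.2
    simp only [polarCoord_symm_apply, sub_sub, hsum, hκ, smul_eq_mul]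
    ring
  simp only [hpolar]
  have h1 := (hi 1 0).const_mul (4 * c ^ 2)
  have h2 := (hi 2 1).const_mul (16 * c)
  rw [integral_const_mul, integral_add (by exact h1.sub h2) ((hi 3 2).const_mul 16),
    integral_sub h1 h2]
  simp only [integral_const_mul]
  rw [integral_prod_mul (κ 1) (fun θ => cos θ ^ 0), integral_prod_mul (κ 2) (fun θ => cos θ ^ 1),
    integral_prod_mul (κ 3) (fun θ => cos θ ^ 2)]
  simp only [pow_zero, pow_one, integral_cos_Ioo_neg_pi_pi, integral_cos_sq_Ioo_neg_pi_pi]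
  have hone : ∫ _ in Set.Ioo (-π) π, (1 : ℝ) = 2 * π := by
    simp [Real.volume_real_Ioo_of_le (by linarith [pi_pos] : -π ≤ π)]
    ring
  have hrad : ∫ r in Set.Ioi (0 : ℝ),
      r * |c ^ 2 - r ^ 2| * (c ^ 2 + 2 * r ^ 2) * exp (-(r ^ 2 / 2)) =
      c ^ 2 * (∫ r in Set.Ioi 0, κ 1 r) + 2 * ∫ r in Set.Ioi 0, κ 3 r := by
    rw [← integral_const_mul, ← integral_const_mul,
      ← integral_add ((hκi 1).const_mul _) ((hκi 3).const_mul _)]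
    refine integral_congr_ae (.of_forall fun r => ?_)
    simp only [hκ]
    ring
  rw [hone, hrad]
  field_simp
  ring

lemma integrable_pow_gaussianReal (n : ℕ) : Integrable (fun x : ℝ => x ^ n) (gaussianReal 0 1) := by
  have h := (memLp_id_gaussianReal (μ := 0) (v := 1) (n : NNReal))
  have h' : MemLp (id : ℝ → ℝ) (n : ENNReal) (gaussianReal 0 1) := by exact_mod_cast h
  exact (h'.integrable_norm_pow').mono (by fun_prop) (.of_forall fun x => by simp)

lemma integrable_monomial_gaussian (i j k : ℕ) :
    Integrable (fun p : ℝ × ℝ × ℝ => p.1 ^ i * (p.2.1 ^ j * p.2.2 ^ k))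
      ((gaussianReal 0 1).prod ((gaussianReal 0 1).prod (gaussianReal 0 1))) :=
  (integrable_pow_gaussianReal i).mul_prod
    ((integrable_pow_gaussianReal j).mul_prod (integrable_pow_gaussianReal k))

lemma integrable_abs_mul_sq_gaussian :
    Integrable (fun p : ℝ × ℝ × ℝ => |(√2 * p.1) ^ 2 - p.2.1 ^ 2 - p.2.2 ^ 2| *
      (2 * (√2 * p.1) - 4 * p.2.1) ^ 2)
      ((gaussianReal 0 1).prod ((gaussianReal 0 1).prod (gaussianReal 0 1))) := by
  have hm := integrable_monomial_gaussian
  have h := (((((hm 4 0 0).const_mul (4 * √2 ^ 4)).sub ((hm 3 1 0).const_mul (16 * √2 ^ 3))).add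
    ((hm 2 2 0).const_mul (12 * √2 ^ 2))).sub ((hm 2 0 2).const_mul (4 * √2 ^ 2))).add
    (((((hm 1 3 0).const_mul (16 * √2)).add ((hm 1 1 2).const_mul (16 * √2))).sub
    ((hm 0 4 0).const_mul 16)).sub ((hm 0 2 2).const_mul 16))
  refine h.mono (by fun_prop) (.of_forall fun p => le_of_eq ?_)
  simp only [Pi.add_apply, Pi.sub_apply]
  rw [norm_mul, Real.norm_eq_abs, abs_abs, ← Real.norm_eq_abs, ← norm_mul]
  congr 1
  ring

/-- For every interval `I ⊆ ℝ`,
`E[|Z₁Z₃ − Z₂²| (3Z₃ − Z₁)² 𝟙{(Z₁+Z₃)/√8 ∈ I}]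
  = 8 ∫_I √(2/π)(−4 + t² + t⁴ + 2e^{−t²}(4 + 3t²))e^{−t²/2} dt`. -/
theorem abs_det_indicator_expectation_p2
    {Ω : Type} [MeasureSpace Ω] [IsProbabilityMeasure (volume : Measure Ω)]
    (Z : Ω → Fin 3 → ℝ) (hZ : IsGaussianZ Z) (I : Set ℝ) (hI : I.OrdConnected) :
    (∫ ω, |Z ω 0 * Z ω 2 - Z ω 1 ^ 2| * (3 * Z ω 2 - Z ω 0) ^ 2 *
        I.indicator (fun _ => (1 : ℝ)) ((Z ω 0 + Z ω 2) / Real.sqrt 8)) =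
      8 * ∫ t in I, Real.sqrt (2 / π) *
        (-4 + t ^ 2 + t ^ 4 + 2 * Real.exp (-t ^ 2) * (4 + 3 * t ^ 2)) *
        Real.exp (-(t ^ 2 / 2)) := by
  have hmI : MeasurableSet I := hI.measurableSet
  set γ := gaussianReal 0 1 with hγ
  set G : ℝ × ℝ × ℝ → ℝ := fun p => |(√2 * p.1) ^ 2 - p.2.1 ^ 2 - p.2.2 ^ 2| *
    (2 * (√2 * p.1) - 4 * p.2.1) ^ 2 with hG
  set H : ℝ × ℝ × ℝ → ℝ := fun p => G p * I.indicator (fun _ => (1 : ℝ)) p.1 with hH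
  have hind : Measurable (I.indicator (fun _ => (1 : ℝ))) := measurable_const.indicator hmI
  have hHi : Integrable H (γ.prod (γ.prod γ)) := by
    refine integrable_abs_mul_sq_gaussian.mono (by fun_prop) (.of_forall fun p => ?_)
    simp only [hH, norm_mul (G p)]
    refine mul_le_of_le_one_right (norm_nonneg _) ?_
    by_cases hp : p.1 ∈ I <;> simp [hp]
  have hchange : (∫ ω, |Z ω 0 * Z ω 2 - Z ω 1 ^ 2| * (3 * Z ω 2 - Z ω 0) ^ 2 *
      I.indicator (fun _ => (1 : ℝ)) ((Z ω 0 + Z ω 2) / √8)) =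
      ∫ p, H p ∂(γ.prod (γ.prod γ)) := by
    rw [← hZ.map_eq_prod, integral_map hZ.aemeasurable_normalized
      (by fun_prop : Measurable H).aestronglyMeasurable]
    refine integral_congr_ae (.of_forall fun ω => ?_)
    have hs : √2 * ((Z ω 0 + Z ω 2) / √8) = (Z ω 0 + Z ω 2) / 2 := by
      have h8 : √8 = 2 * √2 := by
        rw [show (8 : ℝ) = 2 ^ 2 * 2 by norm_num, Real.sqrt_mul (by norm_num),
          Real.sqrt_sq (by norm_num)]
      rw [h8]
      field_simp
    simp only [hH, hG, hs]
    congr 3 <;> ring_nf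
  have hinner : ∀ t : ℝ, ∫ w, H (t, w) ∂(γ.prod γ) = I.indicator (fun t =>
      16 * (-4 + t ^ 2 + t ^ 4 + 2 * exp (-t ^ 2) * (4 + 3 * t ^ 2))) t := by
    intro t
    have h2 : √2 ^ 2 = 2 := Real.sq_sqrt (by norm_num)
    have h4 : √2 ^ 4 = 4 := by
      rw [show 4 = 2 * 2 from rfl, pow_mul, h2]
      norm_num
    simp only [hH, hG]
    rw [integral_mul_const, integral_abs_mul_sq_gaussian]
    by_cases ht : t ∈ I
    · simp only [ht, Set.indicator_of_mem, mul_pow, h2, h4, mul_one]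
      rw [mul_div_cancel_left₀ _ (two_ne_zero)]
      ring
    · simp [ht]
  rw [hchange, integral_prod _ hHi]
  simp only [hinner]
  rw [hγ, integral_gaussianReal_eq_integral_smul one_ne_zero, ← integral_const_mul,
    ← integral_indicator hmI]
  refine integral_congr_ae (.of_forall fun t => ?_)
  by_cases ht : t ∈ I
  · have hs : √(2 / π) = 2 * (√(2 * π))⁻¹ := by
      rw [show 2 / π = 2 ^ 2 * (2 * π)⁻¹ by field_simp, Real.sqrt_mul (by norm_num),
        Real.sqrt_sq (by norm_num), Real.sqrt_inv]
    simp only [ht, Set.indicator_of_mem, gaussianPDFReal, smul_eq_mul, sub_zero, NNReal.coe_one,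
      mul_one, hs, neg_div]
    ring
  · simp [ht]
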